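/- Let d ≥ 2 be an integer and μ > 0 a real constant, and define the Fermi–Dirac pressure P_FD(z) = (μ/d)·f_{d/2}( f_{d/2−1}^(−1)(2z/μ) ) for z > 0. Then P_FD is nonnegative, strictly increasing and convex on (0,∞). -/

import Mathlib

open Set MeasureTheory Function

/-- The Fermi function of order `α`. -/
noncomputable def fermi (α z : ℝ) : ℝ :=
  ∫ x in Set.Ioi (0:ℝ), x ^ α / (1 + Real.exp (x - z))

/-- The Fermi--Dirac pressure. -/
noncomputable def fermiDiracPressure (d : ℕ) (μ : ℝ) (z : ℝ) : ℝ :=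
  (μ / d) * fermi ((d : ℝ) / 2)
    (Function.invFun (fermi ((d : ℝ) / 2 - 1)) (2 * z / μ))

lemma fermi_integrable {α : ℝ} (hα : -1 < α) (z : ℝ) :
    IntegrableOn (fun x : ℝ => x ^ α / (1 + Real.exp (x - z))) (Set.Ioi 0) := by
  have h := (Real.GammaIntegral_convergent (s := α + 1) (by linarith)).const_mul (Real.exp z)
  refine Integrable.mono' h ?_ ?_
  · refine Measurable.aestronglyMeasurable ?_
    fun_prop
  · refine (ae_restrict_mem measurableSet_Ioi).mono fun x hx => ?_
    have hx0 : 0 < x := hx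
    have hp : 0 < x ^ α := Real.rpow_pos_of_pos hx0 α
    have he := Real.exp_pos (x - z)
    rw [Real.norm_of_nonneg (by positivity), div_le_iff₀ (by positivity)]
    have e1 : Real.exp z * Real.exp (-x) * Real.exp (x - z) = 1 := by
      rw [← Real.exp_add, ← Real.exp_add, Real.exp_eq_one_iff]; ring
    have : 0 < Real.exp z * Real.exp (-x) := by positivity
    have e2 : α + 1 - 1 = α := by ring
    rw [e2]
    calc x ^ α = x ^ α * 1 := by ring
      _ ≤ x ^ α * (Real.exp z * Real.exp (-x) + Real.exp z * Real.exp (-x) * Real.exp (x - z)) := by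
        gcongr; linarith
      _ = _ := by ring

lemma fermi_integrand_lt {α a b x : ℝ} (hab : a < b) (hx : 0 < x) :
    x ^ α / (1 + Real.exp (x - a)) < x ^ α / (1 + Real.exp (x - b)) := by
  have hp : 0 < x ^ α := Real.rpow_pos_of_pos hx α
  have : Real.exp (x - b) < Real.exp (x - a) := Real.exp_lt_exp.2 (by linarith)
  have := Real.exp_pos (x - b)
  gcongr

lemma setIntegral_pos_of_pos {g : ℝ → ℝ} (hg : IntegrableOn g (Set.Ioi 0))
    (hpos : ∀ x, 0 < x → 0 < g x) : 0 < ∫ x in Set.Ioi (0:ℝ), g x := by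
  rw [setIntegral_pos_iff_support_of_nonneg_ae]
  · have : Function.support g ∩ Set.Ioi 0 = Set.Ioi (0:ℝ) := by
      ext x
      simp only [Set.mem_inter_iff, Function.mem_support, Set.mem_Ioi, and_iff_right_iff_imp]
      exact fun h => (hpos x h).ne'
    rw [this]; simp
  · exact (ae_restrict_mem measurableSet_Ioi).mono fun x hx => (hpos x hx).le
  · exact hg

lemma fermi_pos {α : ℝ} (hα : -1 < α) (z : ℝ) : 0 < fermi α z := by
  refine setIntegral_pos_of_pos (fermi_integrable hα z) fun x hx => ?_
  have hp : 0 < x ^ α := Real.rpow_pos_of_pos hx α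
  positivity

lemma fermi_strictMono {α : ℝ} (hα : -1 < α) : StrictMono (fermi α) := by
  intro a b hab
  rw [← sub_pos]
  unfold fermi
  rw [← integral_sub (fermi_integrable hα b) (fermi_integrable hα a)]
  exact setIntegral_pos_of_pos ((fermi_integrable hα b).sub (fermi_integrable hα a))
    fun x hx => sub_pos.2 (fermi_integrand_lt hab hx)

lemma fermi_continuous {α : ℝ} (hα : -1 < α) : Continuous (fermi α) := by
  rw [continuous_iff_continuousAt]
  intro z
  refine continuousAt_of_dominated
    (bound := fun x : ℝ => x ^ α / (1 + Real.exp (x - (z + 1)))) ?_ ?_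
    (fermi_integrable hα (z + 1)) ?_
  · exact Filter.Eventually.of_forall fun w => (fermi_integrable hα w).aestronglyMeasurable
  · filter_upwards [Iio_mem_nhds (show z < z + 1 by linarith)] with w hw
    refine (ae_restrict_mem measurableSet_Ioi).mono fun x hx => ?_
    have hx0 : 0 < x := hx
    have hp : 0 < x ^ α := Real.rpow_pos_of_pos hx0 α
    rw [Real.norm_of_nonneg (by positivity)]
    exact (fermi_integrand_lt hw hx0).le
  · refine Filter.Eventually.of_forall fun x => ?_
    refine Continuous.continuousAt ?_
    have : ∀ w : ℝ, 1 + Real.exp (x - w) ≠ 0 := fun w => by positivity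
    fun_prop (disch := assumption)

lemma fermi_le {α : ℝ} (hα : -1 < α) (z : ℝ) :
    fermi α z ≤ Real.exp z * Real.Gamma (α + 1) := by
  have h := Real.GammaIntegral_convergent (s := α + 1) (by linarith)
  rw [Real.Gamma_eq_integral (by linarith), ← integral_const_mul]
  refine setIntegral_mono_on (fermi_integrable hα z) (h.const_mul _) measurableSet_Ioi ?_
  intro x hx
  have hx0 : 0 < x := hx
  have hp : 0 < x ^ α := Real.rpow_pos_of_pos hx0 α
  have he := Real.exp_pos (x - z)
  rw [div_le_iff₀ (by positivity)]
  have e1 : Real.exp z * Real.exp (-x) * Real.exp (x - z) = 1 := by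
    rw [← Real.exp_add, ← Real.exp_add, Real.exp_eq_one_iff]; ring
  have : 0 < Real.exp z * Real.exp (-x) := by positivity
  have e2 : α + 1 - 1 = α := by ring
  rw [e2]
  calc x ^ α = x ^ α * 1 := by ring
    _ ≤ x ^ α * (Real.exp z * Real.exp (-x) + Real.exp z * Real.exp (-x) * Real.exp (x - z)) := by
      gcongr; linarith
    _ = _ := by ring

lemma le_fermi {α : ℝ} (hα : 0 ≤ α) {z : ℝ} (hz : 1 ≤ z) : (z - 1) / 2 ≤ fermi α z := by
  have hi := fermi_integrable (by linarith : -1 < α) z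
  have hsub : Set.Ioc 1 z ⊆ Set.Ioi (0:ℝ) := fun x hx => lt_trans one_pos hx.1
  have h1 : ∫ x in Set.Ioc 1 z, (1/2 : ℝ) = (z - 1) / 2 := by
    simp [hz]; ring
  rw [← h1]
  refine le_trans ?_ (setIntegral_mono_set hi ?_ hsub.eventuallyLE)
  · refine setIntegral_mono_on (by simp) (hi.mono_set hsub) measurableSet_Ioc ?_
    intro x hx
    have hp : 1 ≤ x ^ α := Real.one_le_rpow hx.1.le hα
    have he : Real.exp (x - z) ≤ 1 := Real.exp_le_one_iff.2 (by linarith [hx.2])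
    rw [div_le_div_iff₀ (by norm_num) (by positivity)]
    linarith
  · refine (ae_restrict_mem measurableSet_Ioi).mono fun x hx => ?_
    have hx0 : 0 < x := hx
    have hp : 0 < x ^ α := Real.rpow_pos_of_pos hx0 α
    show 0 ≤ _
    positivity

lemma fermi_surj {α : ℝ} (hα : 0 ≤ α) {y : ℝ} (hy : 0 < y) : ∃ z, fermi α z = y := by
  have hα' : -1 < α := by linarith
  have hG : 0 < Real.Gamma (α + 1) := Real.Gamma_pos_of_pos (by linarith)
  refine mem_range_of_exists_le_of_exists_ge (fermi_continuous hα')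
    ⟨Real.log (y / Real.Gamma (α + 1)), ?_⟩ ⟨2 * y + 1, ?_⟩
  · refine (fermi_le hα' _).trans ?_
    rw [Real.exp_log (by positivity)]
    field_simp; rfl
  · have := le_fermi hα (z := 2 * y + 1) (by linarith)
    linarith

lemma fermi_key {α : ℝ} (hα : -1 < α) {a b c : ℝ} (hab : a < b) (hbc : b < c) :
    (fermi (α + 1) b - fermi (α + 1) a) * (fermi α c - fermi α b) ≤
      (fermi (α + 1) c - fermi (α + 1) b) * (fermi α b - fermi α a) := by
  have hα1 : -1 < α + 1 := by linarith
  have hI := fermi_integrable hα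
  have hJ := fermi_integrable hα1
  set D1 := fermi α b - fermi α a with hD1
  set N1 := fermi (α + 1) b - fermi (α + 1) a with hN1
  have hD1pos : 0 < D1 := sub_pos.2 (fermi_strictMono hα hab)
  set m := N1 / D1 with hm
  set C := (Real.exp (-b) - Real.exp (-c)) / (Real.exp (-a) - Real.exp (-b)) with hC
  have hab' : Real.exp (-b) < Real.exp (-a) := Real.exp_lt_exp.2 (by linarith)
  have hbc' : Real.exp (-c) < Real.exp (-b) := Real.exp_lt_exp.2 (by linarith)
  have hCpos : 0 < C := div_pos (by linarith) (by linarith)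
  set r : ℝ → ℝ := fun x => C * ((1 + Real.exp (x - a)) / (1 + Real.exp (x - c))) with hr
  have hrmono : Monotone r := by
    intro x y hxy
    simp only [hr]
    gcongr C * ?_
    rw [div_le_div_iff₀ (by positivity) (by positivity)]
    simp only [sub_eq_add_neg, Real.exp_add]
    have h1 := Real.exp_le_exp.2 hxy
    nlinarith [mul_nonneg (sub_nonneg.2 h1) (sub_nonneg.2 (hbc'.trans hab').le)]
  -- pointwise inequality
  have hpt : ∀ x ∈ Set.Ioi (0:ℝ),
      r m * ((x ^ (α + 1) / (1 + Real.exp (x - b)) - x ^ (α + 1) / (1 + Real.exp (x - a)))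
        - m * (x ^ α / (1 + Real.exp (x - b)) - x ^ α / (1 + Real.exp (x - a)))) ≤
      (x ^ (α + 1) / (1 + Real.exp (x - c)) - x ^ (α + 1) / (1 + Real.exp (x - b)))
        - m * (x ^ α / (1 + Real.exp (x - c)) - x ^ α / (1 + Real.exp (x - b))) := by
    intro x hx
    have hx0 : 0 < x := hx
    have hp : x ^ (α + 1) = x ^ α * x := Real.rpow_add_one hx0.ne' α
    have hlt := fermi_integrand_lt (α := α) hab hx0
    have hratio : x ^ α / (1 + Real.exp (x - c)) - x ^ α / (1 + Real.exp (x - b)) =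
        r x * (x ^ α / (1 + Real.exp (x - b)) - x ^ α / (1 + Real.exp (x - a))) := by
      simp only [hr, hC, sub_eq_add_neg, Real.exp_add]
      have h0 : Real.exp (-a) + -Real.exp (-b) ≠ 0 := by linarith
      field_simp
      ring
    set k := x ^ α / (1 + Real.exp (x - b)) - x ^ α / (1 + Real.exp (x - a)) with hk
    have hkpos : 0 < k := sub_pos.2 hlt
    have e1 : x ^ (α + 1) / (1 + Real.exp (x - b)) - x ^ (α + 1) / (1 + Real.exp (x - a))
        = x * k := by rw [hp, hk]; ring
    have e2 : x ^ (α + 1) / (1 + Real.exp (x - c)) - x ^ (α + 1) / (1 + Real.exp (x - b))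
        = x * (r x * k) := by rw [hp, ← hratio]; ring
    rw [e1, e2, hratio]
    have h3 : 0 ≤ (x - m) * (r x - r m) := by
      rcases le_total x m with h | h
      · exact mul_nonneg_of_nonpos_of_nonpos (by linarith) (by linarith [hrmono h])
      · exact mul_nonneg (by linarith) (by linarith [hrmono h])
    nlinarith [mul_nonneg h3 hkpos.le]
  have hA : IntegrableOn (fun x : ℝ => x ^ (α + 1) / (1 + Real.exp (x - b)) -
      x ^ (α + 1) / (1 + Real.exp (x - a))) (Set.Ioi 0) := (hJ b).sub (hJ a)
  have hB : IntegrableOn (fun x : ℝ => x ^ α / (1 + Real.exp (x - b)) -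
      x ^ α / (1 + Real.exp (x - a))) (Set.Ioi 0) := (hI b).sub (hI a)
  have hA' : IntegrableOn (fun x : ℝ => x ^ (α + 1) / (1 + Real.exp (x - c)) -
      x ^ (α + 1) / (1 + Real.exp (x - b))) (Set.Ioi 0) := (hJ c).sub (hJ b)
  have hB' : IntegrableOn (fun x : ℝ => x ^ α / (1 + Real.exp (x - c)) -
      x ^ α / (1 + Real.exp (x - b))) (Set.Ioi 0) := (hI c).sub (hI b)
  have hint := setIntegral_mono_on ((hA.sub (hB.const_mul m)).const_mul (r m))
    (hA'.sub (hB'.const_mul m)) measurableSet_Ioi hpt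
  simp only [Pi.sub_apply] at hint
  rw [integral_const_mul, integral_sub hA (hB.const_mul m), integral_sub hA' (hB'.const_mul m),
    integral_const_mul, integral_const_mul] at hint
  rw [integral_sub (hJ b) (hJ a), integral_sub (hJ c) (hJ b), integral_sub (hI b) (hI a),
    integral_sub (hI c) (hI b)] at hint
  change r m * (N1 - m * D1) ≤ (fermi (α + 1) c - fermi (α + 1) b)
    - m * (fermi α c - fermi α b) at hint
  have hmD : m * D1 = N1 := by rw [hm]; field_simp
  rw [hmD, sub_self, mul_zero] at hint
  rw [← hmD]
  nlinarith [mul_nonneg hint hD1pos.le]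

theorem fermiDiracPressure_nonneg_strictMono_convex
    (d : ℕ) (hd : 2 ≤ d) (μ : ℝ) (hμ : 0 < μ) :
    (∀ z ∈ Set.Ioi (0:ℝ), 0 ≤ fermiDiracPressure d μ z) ∧
    StrictMonoOn (fermiDiracPressure d μ) (Set.Ioi 0) ∧
    ConvexOn ℝ (Set.Ioi 0) (fermiDiracPressure d μ) := by
  have hd' : (2:ℝ) ≤ d := by exact_mod_cast hd
  obtain ⟨α, hαd⟩ : ∃ α : ℝ, α = (d:ℝ) / 2 - 1 := ⟨_, rfl⟩
  have hα : 0 ≤ α := by linarith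
  have hα' : -1 < α := by linarith
  have hα1 : (d:ℝ) / 2 = α + 1 := by linarith
  have hα1' : -1 < α + 1 := by linarith
  have hμd : 0 < μ / d := by positivity
  set g : ℝ → ℝ := fun z => Function.invFun (fermi α) (2 * z / μ) with hg
  have hP : ∀ z, fermiDiracPressure d μ z = (μ / d) * fermi (α + 1) (g z) := by
    intro z
    simp only [fermiDiracPressure, hg, hα1, add_sub_cancel_right]
  have hfg : ∀ z, 0 < z → fermi α (g z) = 2 * z / μ := fun z hz =>
    Function.invFun_eq (fermi_surj hα (by positivity))
  have hgmono : ∀ x y, 0 < x → x < y → g x < g y := by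
    intro x y hx hxy
    rw [← (fermi_strictMono hα').lt_iff_lt, hfg x hx, hfg y (hx.trans hxy)]
    gcongr
  refine ⟨fun z _ => ?_, ?_, ?_⟩
  · rw [hP]
    exact mul_nonneg hμd.le (fermi_pos hα1' _).le
  · intro x hx y _ hxy
    rw [hP, hP]
    exact mul_lt_mul_of_pos_left (fermi_strictMono hα1' (hgmono x y hx hxy)) hμd
  · refine convexOn_of_slope_mono_adjacent (convex_Ioi 0) ?_
    intro x y z hx _ hxy hyz
    have hx0 : 0 < x := hx
    have hy0 : 0 < y := hx0.trans hxy
    have hz0 : 0 < z := hy0.trans hyz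
    have hkey := fermi_key hα' (hgmono x y hx0 hxy) (hgmono y z hy0 hyz)
    rw [hfg x hx0, hfg y hy0, hfg z hz0] at hkey
    rw [hP, hP, hP, div_le_div_iff₀ (by linarith) (by linarith)]
    have hc : 0 < μ / d * (μ / 2) := by positivity
    have := mul_le_mul_of_nonneg_left hkey hc.le
    convert this using 1 <;> field_simp
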